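/- Let L be a finite-dimensional nilpotent complex Lie algebra of nilpotency class two. Then L is isomorphic to a Lie algebra direct sum H ⊕ K, where K is abelian and H is a generalized Heisenberg Lie algebra, i.e., [H,H] = Z(H). -/

import Mathlib

/-- The Lie algebra direct sum `H ⊕ K`, realized as the product `H × K` with
componentwise bracket. -/
instance Prod.instLieRingOfLieRing {L M : Type} [LieRing L] [LieRing M] :
    LieRing (L × M) where
  bracket p q := (⁅p.1, q.1⁆, ⁅p.2, q.2⁆)
  add_lie x y z := Prod.ext (add_lie x.1 y.1 z.1) (add_lie x.2 y.2 z.2)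
  lie_add x y z := Prod.ext (lie_add x.1 y.1 z.1) (lie_add x.2 y.2 z.2)
  lie_self x := Prod.ext (lie_self x.1) (lie_self x.2)
  leibniz_lie x y z := Prod.ext (leibniz_lie x.1 y.1 z.1) (leibniz_lie x.2 y.2 z.2)

instance Prod.instLieAlgebraOfLieAlgebra {R : Type} [CommRing R] {L M : Type}
    [LieRing L] [LieRing M] [LieAlgebra R L] [LieAlgebra R M] :
    LieAlgebra R (L × M) where
  lie_smul t x y := Prod.ext (lie_smul t x.1 y.1) (lie_smul t x.2 y.2)

/-- A Lie algebra has nilpotency class two if `[L,L] ≠ 0` and `[[L,L],L] = 0`. -/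
def IsNilpotentClassTwo (L : Type) [LieRing L] [LieAlgebra ℂ L] : Prop :=
  ⁅(⊤ : LieIdeal ℂ L), (⊤ : LieIdeal ℂ L)⁆ ≠ ⊥ ∧
    ⁅⁅(⊤ : LieIdeal ℂ L), (⊤ : LieIdeal ℂ L)⁆, (⊤ : LieIdeal ℂ L)⁆ = ⊥

section

variable {R L : Type*} [LieRing L]

/-- If `[L, L]` is central, then a complement in `L` of a complement of `[L, L]` in the center,
chosen to contain `[L, L]`, is a subalgebra meeting the center inside `[L, L]`. -/
theorem LieAlgebra.exists_isCompl_of_derived_le_center [Field R] [LieAlgebra R L]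
    (h : ⁅(⊤ : LieIdeal R L), (⊤ : LieIdeal R L)⁆ ≤ LieAlgebra.center R L) :
    ∃ H K : LieSubalgebra R L, IsCompl H.toSubmodule K.toSubmodule ∧
      (∀ x ∈ K, x ∈ LieAlgebra.center R L) ∧
      ∀ x ∈ H, x ∈ LieAlgebra.center R L → x ∈ ⁅(⊤ : LieIdeal R L), (⊤ : LieIdeal R L)⁆ := by
  set D : LieIdeal R L := ⁅(⊤ : LieIdeal R L), (⊤ : LieIdeal R L)⁆
  obtain ⟨K, hDK, hsup⟩ := IsModularLattice.exists_disjoint_and_sup_eq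
    (show D.toSubmodule ≤ (LieAlgebra.center R L).toSubmodule from h)
  obtain ⟨H, hDH, hHK⟩ := hDK.exists_isCompl
  have hKZ : ∀ x ∈ K, x ∈ LieAlgebra.center R L := fun x hx =>
    (hsup ▸ le_sup_right : K ≤ (LieAlgebra.center R L).toSubmodule) hx
  refine ⟨{ H with
      lie_mem' := fun {x y} _ _ => hDH <|
        LieSubmodule.lie_mem_lie (LieSubmodule.mem_top x) (LieSubmodule.mem_top y) },
    { K with
      lie_mem' := fun {x y} _ hy => by
        rw [(LieModule.mem_maxTrivSubmodule R L L y).mp (hKZ y hy) x]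
        exact K.zero_mem },
    hHK, hKZ, fun x hxH hxZ => ?_⟩
  have hx : x ∈ D.toSubmodule ⊔ K := by rwa [hsup]
  obtain ⟨d, hd, k, hk, rfl⟩ := Submodule.mem_sup.mp hx
  have hkH : k ∈ H := by
    have := H.sub_mem hxH (hDH hd)
    rwa [add_sub_cancel_left] at this
  rw [Submodule.disjoint_def.mp hHK.disjoint k hkH hk, add_zero]
  exact hd

variable [CommRing R] [LieAlgebra R L] {H K : LieSubalgebra R L}

/-- A central element of a subalgebra with a central complement is central. -/
theorem LieSubalgebra.coe_mem_center_of_codisjoint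
    (hHK : Codisjoint H.toSubmodule K.toSubmodule)
    (hK : ∀ x ∈ K, x ∈ LieAlgebra.center R L) {z : H} (hz : z ∈ LieAlgebra.center R H) :
    (z : L) ∈ LieAlgebra.center R L := by
  rw [LieModule.mem_maxTrivSubmodule] at hz ⊢
  intro x
  obtain ⟨a, b, ha, hb, rfl⟩ := Submodule.codisjoint_iff_exists_add_eq.mp hHK x
  have h₁ : ⁅a, (z : L)⁆ = 0 := congrArg Subtype.val (hz ⟨a, ha⟩)
  have h₂ : ⁅b, (z : L)⁆ = 0 := by
    rw [← lie_skew, (LieModule.mem_maxTrivSubmodule R L L b).mp (hK b hb), neg_zero]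
  rw [add_lie, h₁, h₂, add_zero]

/-- A subalgebra with a central complement has the same derived algebra as the ambient one. -/
theorem LieSubalgebra.derived_le_map_derived_of_codisjoint
    (hHK : Codisjoint H.toSubmodule K.toSubmodule)
    (hK : ∀ x ∈ K, x ∈ LieAlgebra.center R L) :
    (⁅(⊤ : LieIdeal R L), (⊤ : LieIdeal R L)⁆).toSubmodule ≤
      (⁅(⊤ : LieIdeal R H), (⊤ : LieIdeal R H)⁆).toSubmodule.map H.toSubmodule.subtype := by
  rw [LieSubmodule.lieIdeal_oper_eq_linear_span', Submodule.span_le]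
  rintro _ ⟨x, -, y, -, rfl⟩
  obtain ⟨a, b, ha, hb, rfl⟩ := Submodule.codisjoint_iff_exists_add_eq.mp hHK x
  obtain ⟨c, d, hc, hd, rfl⟩ := Submodule.codisjoint_iff_exists_add_eq.mp hHK y
  have hb' : ⁅b, c⁆ = 0 := by
    rw [← lie_skew, (LieModule.mem_maxTrivSubmodule R L L b).mp (hK b hb), neg_zero]
  have hd' := (LieModule.mem_maxTrivSubmodule R L L d).mp (hK d hd)
  refine ⟨⁅(⟨a, ha⟩ : H), (⟨c, hc⟩ : H)⁆,
    LieSubmodule.lie_mem_lie (LieSubmodule.mem_top _) (LieSubmodule.mem_top _), ?_⟩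
  rw [lie_add, hd', add_zero, add_lie, hb', add_zero]
  rfl

end

/-- A finite-dimensional nilpotent complex Lie algebra of nilpotency class two is
isomorphic to a Lie algebra direct sum `H ⊕ K`, where `K` is abelian and `H` is a
generalized Heisenberg Lie algebra, i.e. `[H,H] = Z(H)`. -/
theorem classTwo_decomposition (L : Type) [LieRing L] [LieAlgebra ℂ L]
    [Module.Finite ℂ L] (h2 : IsNilpotentClassTwo L) :
    ∃ (H : Type) (_iH : LieRing H),
      letI := _iH
      ∃ _jH : LieAlgebra ℂ H,
        letI := _jH
        ∃ (K : Type) (_iK : LieRing K),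
          letI := _iK
          ∃ _jK : LieAlgebra ℂ K,
            letI := _jK
            IsLieAbelian K ∧
              ⁅(⊤ : LieIdeal ℂ H), (⊤ : LieIdeal ℂ H)⁆ = LieAlgebra.center ℂ H ∧
              Nonempty (L ≃ₗ⁅ℂ⁆ H × K) := by
  have hDZ : ⁅(⊤ : LieIdeal ℂ L), (⊤ : LieIdeal ℂ L)⁆ ≤ LieAlgebra.center ℂ L := by
    intro z hz
    rw [LieModule.mem_maxTrivSubmodule]
    intro x
    have : ⁅z, x⁆ ∈ (⊥ : LieIdeal ℂ L) :=
      h2.2 ▸ LieSubmodule.lie_mem_lie hz (LieSubmodule.mem_top x)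
    rw [← lie_skew, (LieSubmodule.mem_bot _).mp this, neg_zero]
  obtain ⟨H, K, hHK, hK, hHD⟩ := LieAlgebra.exists_isCompl_of_derived_le_center hDZ
  have hK' (x : L) {k : L} (hk : k ∈ K) : ⁅x, k⁆ = 0 :=
    (LieModule.mem_maxTrivSubmodule ℂ L L k).mp (hK k hk) x
  have hK'' (x : L) {k : L} (hk : k ∈ K) : ⁅k, x⁆ = 0 := by
    rw [← lie_skew, hK' x hk, neg_zero]
  refine ⟨H, inferInstance, inferInstance, K, inferInstance, inferInstance,
    ⟨fun x y => Subtype.ext (hK' x y.2)⟩, le_antisymm ?_ ?_, ⟨LieEquiv.symm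
      { Submodule.prodEquivOfIsCompl H.toSubmodule K.toSubmodule hHK with
        map_lie' := fun {p q} => ?_ }⟩⟩
  · rw [LieSubmodule.lie_le_iff]
    intro a _ b _
    rw [LieModule.mem_maxTrivSubmodule]
    intro c
    have hab : ⁅(a : L), (b : L)⁆ ∈ LieAlgebra.center ℂ L :=
      hDZ (LieSubmodule.lie_mem_lie (LieSubmodule.mem_top _) (LieSubmodule.mem_top _))
    exact Subtype.ext ((LieModule.mem_maxTrivSubmodule ℂ L L _).mp hab c)
  · intro z hz
    have hzD := hHD z z.2 (LieSubalgebra.coe_mem_center_of_codisjoint hHK.codisjoint hK hz)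
    obtain ⟨w, hw, hwz⟩ :=
      LieSubalgebra.derived_le_map_derived_of_codisjoint hHK.codisjoint hK hzD
    rwa [← show w = z from Subtype.ext hwz]
  · change ⁅(p.1 : L), (q.1 : L)⁆ + ⁅(p.2 : L), (q.2 : L)⁆ =
      ⁅(p.1 : L) + (p.2 : L), (q.1 : L) + (q.2 : L)⁆
    rw [lie_add, add_lie, hK' _ q.2.2, hK' _ q.2.2, hK'' _ p.2.2]
    simp
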